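/- Let G be an N-function satisfying (H4), 0 < s < 1, Ω ⊂ ℝ^N a bounded domain, 1 < q ≤ p⁻, and let u, v ∈ W^{s,G}_0(Ω) with u > 0, v > 0 a.e. in Ω and u/v, v/u ∈ L^∞(Ω). If equality holds in the G-fractional Díaz–Saa inequality, i.e. ∫∫ g(|u(x)−u(y)|/|x−y|^s)·sign(u(x)−u(y))·[(u(x)^q−v(x)^q)/u(x)^{q−1} − (u(y)^q−v(y)^q)/u(y)^{q−1}]·dx dy/|x−y|^{N+s} + ∫∫ g(|v(x)−v(y)|/|x−y|^s)·sign(v(x)−v(y))·[(v(x)^q−u(x)^q)/v(x)^{q−1} − (v(y)^q−u(y)^q)/v(y)^{q−1}]·dx dy/|x−y|^{N+s} = 0, then (1) u/v is a.e. equal to a positive constant in Ω, and (2) if moreover q ≠ p⁻, then u = v a.e. in Ω. -/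

import Mathlib

open MeasureTheory Filter Set
open scoped ENNReal

noncomputable section

abbrev Euc (N : ℕ) := EuclideanSpace ℝ (Fin N)

/-- An N-function: continuous, convex on `[0,∞)`, vanishing exactly at `0`,
with `G t / t → 0` as `t → 0⁺` and `G t / t → ∞` as `t → ∞`. -/
def IsNFunction (G : ℝ → ℝ) : Prop :=
  ContinuousOn G (Set.Ici 0) ∧ ConvexOn ℝ (Set.Ici 0) G ∧
  (∀ t : ℝ, 0 ≤ t → (G t = 0 ↔ t = 0)) ∧
  Tendsto (fun t => G t / t) (nhdsWithin 0 (Set.Ioi 0)) (nhds 0) ∧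
  Tendsto (fun t => G t / t) atTop atTop

/-- The fractional modular `Φ_{s,G}(u) = ∬_{ℝ^N×ℝ^N} G(|u(x)−u(y)|/|x−y|^s) dx dy/|x−y|^N`. -/
def fracModular (G : ℝ → ℝ) (s : ℝ) (N : ℕ) (u : Euc N → ℝ) : ℝ≥0∞ :=
  ∫⁻ p : Euc N × Euc N,
    ENNReal.ofReal (G (|u p.1 - u p.2| / dist p.1 p.2 ^ s) / dist p.1 p.2 ^ (N : ℝ))

/-- Membership in `W^{s,G}_0(Ω)`: measurable, in `L^G(ℝ^N)`, finite fractional modular for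
some `λ > 0`, and vanishing outside `Ω`. -/
def MemW0 (G : ℝ → ℝ) (s : ℝ) {N : ℕ} (Ω : Set (Euc N)) (u : Euc N → ℝ) : Prop :=
  Measurable u ∧
  (∃ l > 0, (∫⁻ x, ENNReal.ofReal (G (|u x| / l))) ≤ 1) ∧
  (∃ l > 0, fracModular G s N (fun x => u x / l) < ⊤) ∧
  (∀ x ∉ Ω, u x = 0)

/-- The integrand of the G-fractional Díaz–Saa form:
`g(|u(x)−u(y)|/|x−y|^s) · sign(u(x)−u(y)) ·
  [(u(x)^q − v(x)^q)/u(x)^{q−1} − (u(y)^q − v(y)^q)/u(y)^{q−1}] / |x−y|^{N+s}`. -/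
def diazSaaIntegrand (g : ℝ → ℝ) (s q : ℝ) (N : ℕ) (u v : Euc N → ℝ)
    (p : Euc N × Euc N) : ℝ :=
  g (|u p.1 - u p.2| / dist p.1 p.2 ^ s) * Real.sign (u p.1 - u p.2) *
    ((u p.1 ^ q - v p.1 ^ q) / u p.1 ^ (q - 1)
      - (u p.2 ^ q - v p.2 ^ q) / u p.2 ^ (q - 1)) /
    dist p.1 p.2 ^ ((N : ℝ) + s)

/-- The numerator of the Díaz–Saa integrand as a function of the four values
`a = u x`, `b = u y`, `c = v x`, `d = v y`. -/
def diazSaaNumerator (φ : ℝ → ℝ) (q a b c d : ℝ) : ℝ :=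
  φ |a - b| * Real.sign (a - b) *
    ((a ^ q - c ^ q) / a ^ (q - 1) - (b ^ q - d ^ q) / b ^ (q - 1))

theorem diazSaaNumerator_swap (φ : ℝ → ℝ) (q a b c d : ℝ) :
    diazSaaNumerator φ q a b c d = diazSaaNumerator φ q b a d c := by
  unfold diazSaaNumerator
  rw [abs_sub_comm a b, ← neg_sub b a, Real.sign_neg]
  ring

theorem diazSaaNumerator_self (φ : ℝ → ℝ) (q a c d : ℝ) :
    diazSaaNumerator φ q a a c d = 0 := by
  simp [diazSaaNumerator]

theorem rpow_sub_rpow_div_rpow_sub_one {q a : ℝ} (ha : 0 < a) (c : ℝ) :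
    (a ^ q - c ^ q) / a ^ (q - 1) = a - c ^ q / a ^ (q - 1) := by
  rw [sub_div, ← Real.rpow_sub ha]
  simp

/-! Tangent planes of the convex, one-homogeneous function `(d, b) ↦ d ^ q / b ^ (q - 1)`. -/

section Tangent

variable {q z b d : ℝ}

theorem rpow_div_rpow_eq_mul_one_add_rpow (hz : 0 < z) (hb : 0 < b) (hd : 0 < d) :
    d ^ q / b ^ (q - 1) = b * z ^ q * (1 + (d / (z * b) - 1)) ^ q := by
  have h : (1 + (d / (z * b) - 1)) = d / (z * b) := by ring
  rw [h, Real.div_rpow hd.le (by positivity), Real.mul_rpow hz.le hb.le, Real.rpow_sub_one hb.ne']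
  have := Real.rpow_pos_of_pos hz q
  have := Real.rpow_pos_of_pos hb q
  field_simp

theorem tangent_eq_mul_one_add (hz : 0 < z) (hb : 0 < b) :
    q * z ^ (q - 1) * d - (q - 1) * z ^ q * b
      = b * z ^ q * (1 + q * (d / (z * b) - 1)) := by
  rw [Real.rpow_sub_one hz.ne']
  field_simp
  ring

theorem tangent_le_rpow_div_rpow (hq : 1 < q) (hz : 0 < z) (hb : 0 < b) (hd : 0 < d) :
    q * z ^ (q - 1) * d - (q - 1) * z ^ q * b ≤ d ^ q / b ^ (q - 1) := by
  rw [rpow_div_rpow_eq_mul_one_add_rpow hz hb hd, tangent_eq_mul_one_add hz hb]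
  have : 0 < d / (z * b) := by positivity
  exact mul_le_mul_of_nonneg_left
    (one_add_mul_self_le_rpow_one_add (by linarith) hq.le) (by positivity)

theorem tangent_lt_rpow_div_rpow (hq : 1 < q) (hz : 0 < z) (hb : 0 < b) (hd : 0 < d) (h : d ≠ z * b) :
    q * z ^ (q - 1) * d - (q - 1) * z ^ q * b < d ^ q / b ^ (q - 1) := by
  rw [rpow_div_rpow_eq_mul_one_add_rpow hz hb hd, tangent_eq_mul_one_add hz hb]
  have : 0 < d / (z * b) := by positivity
  refine mul_lt_mul_of_pos_left
    (one_add_mul_self_lt_rpow_one_add (by linarith) ?_ hq) (by positivity)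
  intro h0
  exact h (by rwa [sub_eq_zero, div_eq_one_iff_eq (by positivity)] at h0)

theorem rpow_div_rpow_eq_tangent {a c : ℝ} (ha : 0 < a) (hc : 0 < c) :
    c ^ q / a ^ (q - 1) = q * (c / a) ^ (q - 1) * c - (q - 1) * (c / a) ^ q * a := by
  have hz : 0 < c / a := by positivity
  rw [tangent_eq_mul_one_add hz ha, rpow_div_rpow_eq_mul_one_add_rpow hz ha hc]
  have : c / (c / a * a) = 1 := by field_simp
  simp [this]

end Tangent

/-- The discrete Picone inequality, with its equality case. -/
theorem picone {q a b c d : ℝ} (hq : 1 < q) (hb : 0 < b) (hab : b < a) (hc : 0 < c) (hd : 0 < d) :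
    c ^ q / a ^ (q - 1) - d ^ q / b ^ (q - 1) ≤ |c - d| ^ q / (a - b) ^ (q - 1) ∧
    (c * b ≠ d * a →
      c ^ q / a ^ (q - 1) - d ^ q / b ^ (q - 1) < |c - d| ^ q / (a - b) ^ (q - 1)) := by
  have ha : 0 < a := hb.trans hab
  have hX : 0 < a - b := sub_pos.2 hab
  rcases le_or_gt c d with h | h
  · have h0 : 0 ≤ |c - d| ^ q / (a - b) ^ (q - 1) := by positivity
    have h1 : c ^ q / a ^ (q - 1) < d ^ q / b ^ (q - 1) := by
      have h2 : b ^ (q - 1) < a ^ (q - 1) := Real.rpow_lt_rpow hb.le hab (by linarith)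
      have h3 : c ^ q ≤ d ^ q := Real.rpow_le_rpow hc.le h (by linarith)
      exact div_lt_div₀' h3 h2 (by positivity) (by positivity)
    exact ⟨by linarith, fun _ => by linarith⟩
  · have hY : 0 < c - d := sub_pos.2 h
    have hz : 0 < c / a := by positivity
    rw [abs_of_pos hY, rpow_div_rpow_eq_tangent ha hc]
    have h1 := tangent_le_rpow_div_rpow (q := q) hq hz hX hY
    have h2 := tangent_le_rpow_div_rpow (q := q) hq hz hb hd
    refine ⟨by linarith, fun hne => ?_⟩
    have h3 := tangent_lt_rpow_div_rpow (q := q) hq hz hb hd (fun h => hne (by rw [h]; field_simp))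
    linarith

theorem diazSaaNumerator_lower {φ : ℝ → ℝ} (hφ : ∀ t, 0 < t → 0 < φ t) {q a b c d : ℝ}
    (hq : 1 < q) (ha : 0 < a) (hb : 0 < b) (hc : 0 < c) (hd : 0 < d) (hab : a ≠ b) :
    φ |a - b| / |a - b| ^ (q - 1) * (|a - b| ^ q - |c - d| ^ q) ≤ diazSaaNumerator φ q a b c d ∧
    (c * b ≠ d * a →
      φ |a - b| / |a - b| ^ (q - 1) * (|a - b| ^ q - |c - d| ^ q)
        < diazSaaNumerator φ q a b c d) := by
  wlog h : b < a generalizing a b c d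
  · have := this hb ha hd hc hab.symm (lt_of_le_of_ne (not_lt.1 h) hab)
    rw [diazSaaNumerator_swap, abs_sub_comm a, abs_sub_comm c]
    exact ⟨this.1, fun hne => this.2 fun h => hne h.symm⟩
  have hX : 0 < a - b := sub_pos.2 h
  obtain ⟨h1, h2⟩ := picone hq hb h hc hd
  have key : φ |a - b| / |a - b| ^ (q - 1) * (|a - b| ^ q - |c - d| ^ q)
      = φ (a - b) * ((a - b) - |c - d| ^ q / (a - b) ^ (q - 1)) := by
    rw [abs_of_pos hX, ← rpow_sub_rpow_div_rpow_sub_one hX]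
    ring
  have key2 : diazSaaNumerator φ q a b c d
      = φ (a - b) * ((a - b) - (c ^ q / a ^ (q - 1) - d ^ q / b ^ (q - 1))) := by
    rw [diazSaaNumerator, abs_of_pos hX, Real.sign_of_pos hX,
      rpow_sub_rpow_div_rpow_sub_one ha, rpow_sub_rpow_div_rpow_sub_one hb]
    ring
  rw [key, key2]
  exact ⟨mul_le_mul_of_nonneg_left (by linarith) (hφ _ hX).le,
    fun hne => mul_lt_mul_of_pos_left (by linarith [h2 hne]) (hφ _ hX)⟩

/-- For `ψ` monotone, `ψ x - ψ y` and `x ^ q - y ^ q` have the same sign. -/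
theorem rpow_sub_mul_monotone_nonneg {ψ : ℝ → ℝ} (hψ : MonotoneOn ψ (Ioi 0)) {q x y : ℝ}
    (hq : 0 ≤ q) (hx : 0 < x) (hy : 0 < y) : 0 ≤ (x ^ q - y ^ q) * (ψ x - ψ y) := by
  rcases le_total x y with h | h
  · exact mul_nonneg_of_nonpos_of_nonpos
      (sub_nonpos.2 (Real.rpow_le_rpow hx.le h hq)) (sub_nonpos.2 (hψ hx hy h))
  · exact mul_nonneg
      (sub_nonneg.2 (Real.rpow_le_rpow hy.le h hq)) (sub_nonneg.2 (hψ hy hx h))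

theorem rpow_sub_mul_strictMono_pos {ψ : ℝ → ℝ} (hψ : StrictMonoOn ψ (Ioi 0)) {q x y : ℝ}
    (hq : 0 < q) (hx : 0 < x) (hy : 0 < y) (hxy : x ≠ y) :
    0 < (x ^ q - y ^ q) * (ψ x - ψ y) := by
  rcases lt_or_gt_of_ne hxy with h | h
  · exact mul_pos_of_neg_of_neg
      (sub_neg.2 (Real.rpow_lt_rpow hx.le h hq)) (sub_neg.2 (hψ hx hy h))
  · exact mul_pos
      (sub_pos.2 (Real.rpow_lt_rpow hy.le h hq)) (sub_pos.2 (hψ hy hx h))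

section Pointwise

variable {φ : ℝ → ℝ} {q a b c d : ℝ}

theorem diazSaaNumerator_pos_of_left_eq (hφ : ∀ t, 0 < t → 0 < φ t) (hq : 1 < q)
    (ha : 0 < a) (hc : 0 < c) (hd : 0 < d) (hcd : c ≠ d) :
    0 < diazSaaNumerator φ q c d a a := by
  refine lt_of_lt_of_le ?_ (diazSaaNumerator_lower hφ hq hc hd ha ha hcd).1
  have hY : 0 < |c - d| := abs_pos.2 (sub_ne_zero.2 hcd)
  have := hφ _ hY
  rw [sub_self, abs_zero, Real.zero_rpow (by linarith), sub_zero]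
  positivity

theorem diazSaa_pointwise (hφ : ∀ t, 0 < t → 0 < φ t)
    (hmono : MonotoneOn (fun t => φ t / t ^ (q - 1)) (Ioi 0)) (hq : 1 < q)
    (ha : 0 < a) (hb : 0 < b) (hc : 0 < c) (hd : 0 < d) :
    0 ≤ diazSaaNumerator φ q a b c d + diazSaaNumerator φ q c d a b ∧
    (c * b ≠ d * a → 0 < diazSaaNumerator φ q a b c d + diazSaaNumerator φ q c d a b) := by
  by_cases hab : a = b
  · subst hab
    rw [diazSaaNumerator_self, zero_add]
    by_cases hcd : c = d
    · subst hcd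
      rw [diazSaaNumerator_self]
      exact ⟨le_rfl, fun h => absurd rfl h⟩
    · have := diazSaaNumerator_pos_of_left_eq hφ hq ha hc hd hcd
      exact ⟨this.le, fun _ => this⟩
  by_cases hcd : c = d
  · subst hcd
    rw [diazSaaNumerator_self, add_zero]
    have := diazSaaNumerator_pos_of_left_eq hφ hq hc ha hb hab
    exact ⟨this.le, fun _ => this⟩
  have hX : 0 < |a - b| := abs_pos.2 (sub_ne_zero.2 hab)
  have hY : 0 < |c - d| := abs_pos.2 (sub_ne_zero.2 hcd)
  obtain ⟨h1, h1'⟩ := diazSaaNumerator_lower hφ hq ha hb hc hd hab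
  have h2 := (diazSaaNumerator_lower hφ hq hc hd ha hb hcd).1
  have h3 := rpow_sub_mul_monotone_nonneg hmono (q := q) (by linarith) hX hY
  exact ⟨by linarith, fun hne => by linarith [h1' hne]⟩

theorem diazSaa_pointwise_boundary (ha : 0 < a) (hc : 0 < c) :
    diazSaaNumerator φ q a 0 c 0 + diazSaaNumerator φ q c 0 a 0
      = (a ^ q - c ^ q) * (φ a / a ^ (q - 1) - φ c / c ^ (q - 1)) := by
  simp only [diazSaaNumerator, sub_zero, abs_of_pos ha, abs_of_pos hc, Real.sign_of_pos ha,
    Real.sign_of_pos hc, sub_self, zero_div]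
  ring

end Pointwise

/-- Membership of a pair of values in the cone `{0 < u ≤ M v, 0 < v ≤ M u} ∪ {0}`. -/
def ComparablePair (M a c : ℝ) : Prop :=
  (0 < a ∧ 0 < c ∧ a ≤ M * c ∧ c ≤ M * a) ∨ (a = 0 ∧ c = 0)

theorem ComparablePair.symm {M a c : ℝ} (h : ComparablePair M a c) : ComparablePair M c a := by
  rcases h with ⟨h1, h2, h3, h4⟩ | ⟨h1, h2⟩
  · exact Or.inl ⟨h2, h1, h4, h3⟩
  · exact Or.inr ⟨h2, h1⟩

theorem diazSaa_pointwise_nonneg {φ : ℝ → ℝ} {q M a b c d : ℝ} (hφ : ∀ t, 0 < t → 0 < φ t)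
    (hmono : MonotoneOn (fun t => φ t / t ^ (q - 1)) (Ioi 0)) (hq : 1 < q)
    (hac : ComparablePair M a c) (hbd : ComparablePair M b d) :
    0 ≤ diazSaaNumerator φ q a b c d + diazSaaNumerator φ q c d a b := by
  rcases hac with ⟨ha, hc, -, -⟩ | ⟨rfl, rfl⟩ <;> rcases hbd with ⟨hb, hd, -, -⟩ | ⟨rfl, rfl⟩
  · exact (diazSaa_pointwise hφ hmono hq ha hb hc hd).1
  · rw [diazSaa_pointwise_boundary ha hc]
    exact rpow_sub_mul_monotone_nonneg hmono (by linarith) ha hc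
  · rw [diazSaaNumerator_swap, diazSaaNumerator_swap φ q 0, diazSaa_pointwise_boundary hb hd]
    exact rpow_sub_mul_monotone_nonneg hmono (by linarith) hb hd
  · simp [diazSaaNumerator_self]

theorem rpow_div_rpow_sub_le {q M a b c d : ℝ} (hq : 1 < q) (hM : 1 ≤ M)
    (ha : 0 < a) (hb : 0 < b) (hc : 0 < c) (hd : 0 < d) (hca : c ≤ M * a) :
    c ^ q / a ^ (q - 1) - d ^ q / b ^ (q - 1) ≤ q * M ^ q * (|a - b| + |c - d|) := by
  have hz : 0 < c / a := by positivity
  have hzM : c / a ≤ M := (div_le_iff₀ ha).2 hca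
  rw [rpow_div_rpow_eq_tangent ha hc]
  have h1 := tangent_le_rpow_div_rpow (q := q) hq hz hb hd
  have h2 : (c / a) ^ (q - 1) ≤ M ^ q :=
    (Real.rpow_le_rpow hz.le hzM (by linarith)).trans
      (Real.rpow_le_rpow_of_exponent_le hM (by linarith))
  have h3 : (c / a) ^ q ≤ M ^ q := Real.rpow_le_rpow hz.le hzM (by linarith)
  have h4 : q * (c / a) ^ (q - 1) * (c - d) ≤ q * M ^ q * |c - d| := by
    calc q * (c / a) ^ (q - 1) * (c - d) ≤ q * (c / a) ^ (q - 1) * |c - d| := by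
          gcongr
          exact le_abs_self _
      _ ≤ q * M ^ q * |c - d| := by gcongr
  have h5 : (q - 1) * (c / a) ^ q * (b - a) ≤ q * M ^ q * |a - b| := by
    rw [abs_sub_comm]
    calc (q - 1) * (c / a) ^ q * (b - a) ≤ (q - 1) * (c / a) ^ q * |b - a| := by
          have : 0 ≤ q - 1 := by linarith
          gcongr
          exact le_abs_self _
      _ ≤ q * M ^ q * |b - a| := by
          have : 0 ≤ q - 1 := by linarith
          gcongr
          linarith
  linarith

section NFunction

variable {G g g' : ℝ → ℝ} {pm pp : ℝ}

theorem IsNFunction.nonneg (hG : IsNFunction G) {t : ℝ} (ht : 0 ≤ t) : 0 ≤ G t := by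
  obtain ⟨-, hconv, hzero, hlim, -⟩ := hG
  have h0 : G 0 = 0 := (hzero 0 le_rfl).2 rfl
  rcases ht.eq_or_lt with rfl | ht
  · exact h0.ge
  have : 0 ≤ G t / t := by
    refine le_of_tendsto hlim ?_
    filter_upwards [Ioo_mem_nhdsGT ht] with x hx
    have h1 := hconv.2 (Set.mem_Ici.2 le_rfl) (Set.mem_Ici.2 ht.le)
      (sub_nonneg.2 ((div_le_one ht).2 hx.2.le)) (div_nonneg hx.1.le ht.le) (by ring)
    have h2 : x / t * t = x := by field_simp
    simp only [smul_eq_mul, h0, mul_zero, zero_add, h2] at h1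
    rw [div_le_iff₀ hx.1]
    exact h1.trans_eq (by ring)
  simpa [ht.ne'] using mul_nonneg this ht.le

theorem IsNFunction.deriv_pos (hG : IsNFunction G) {t : ℝ} (ht : 0 < t)
    (hGg : HasDerivAt G (g t) t) (hg0 : g t ≠ 0) : 0 < g t := by
  have h0 : G 0 = 0 := (hG.2.2.1 0 le_rfl).2 rfl
  have h1 := hG.2.1.slope_le_of_hasDerivAt (Set.mem_Ici.2 le_rfl) (Set.mem_Ici.2 ht.le) ht hGg
  rw [slope_def_field, h0, sub_zero, sub_zero] at h1
  exact lt_of_le_of_ne ((div_nonneg (hG.nonneg ht.le) ht.le).trans h1) hg0.symm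

theorem IsNFunction.mul_deriv_le (hG : IsNFunction G) {t : ℝ} (ht : 0 < t)
    (hGg : HasDerivAt G (g t) t) : g t * t ≤ G (2 * t) := by
  have h1 := hG.2.1.le_slope_of_hasDerivAt (Set.mem_Ici.2 ht.le)
    (y := 2 * t) (Set.mem_Ici.2 (by linarith)) (by linarith) hGg
  rw [slope_def_field, le_div_iff₀ (by linarith)] at h1
  have := hG.nonneg ht.le
  linarith

theorem hasDerivAt_div_rpow {t : ℝ} (ht : 0 < t) (hgg' : HasDerivAt g (g' t) t) (k : ℝ) :
    HasDerivAt (fun t => g t / t ^ k) ((t * g' t - k * g t) / t ^ (k + 1)) t := by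
  have h := hgg'.div (Real.hasDerivAt_rpow_const (p := k) (Or.inl ht.ne')) (by positivity)
  refine h.congr_deriv ?_
  rw [Real.rpow_sub_one ht.ne', Real.rpow_add_one ht.ne']
  have := Real.rpow_pos_of_pos ht k
  field_simp

theorem continuousOn_div_rpow (hgg' : ∀ t, 0 < t → HasDerivAt g (g' t) t) (k : ℝ) :
    ContinuousOn (fun t => g t / t ^ k) (Set.Ioi 0) := fun t ht =>
  (hasDerivAt_div_rpow ht (hgg' t ht) k).continuousAt.continuousWithinAt

theorem monotoneOn_div_rpow (hgg' : ∀ t, 0 < t → HasDerivAt g (g' t) t) {k : ℝ}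
    (h : ∀ t, 0 < t → k * g t ≤ t * g' t) :
    MonotoneOn (fun t => g t / t ^ k) (Set.Ioi 0) := by
  refine monotoneOn_of_deriv_nonneg (convex_Ioi 0) (continuousOn_div_rpow hgg' k) ?_ ?_
  all_goals
    rw [interior_Ioi]
    intro t (ht : 0 < t)
    have hd := hasDerivAt_div_rpow ht (hgg' t ht) k
  · exact hd.differentiableAt.differentiableWithinAt
  · rw [hd.deriv]
    exact div_nonneg (sub_nonneg.2 (h t ht)) (by positivity)

theorem strictMonoOn_div_rpow (hgg' : ∀ t, 0 < t → HasDerivAt g (g' t) t) {k : ℝ}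
    (h : ∀ t, 0 < t → k * g t < t * g' t) :
    StrictMonoOn (fun t => g t / t ^ k) (Set.Ioi 0) := by
  refine strictMonoOn_of_deriv_pos (convex_Ioi 0) (continuousOn_div_rpow hgg' k) ?_
  rw [interior_Ioi]
  intro t (ht : 0 < t)
  rw [(hasDerivAt_div_rpow ht (hgg' t ht) k).deriv]
  exact div_pos (sub_pos.2 (h t ht)) (by positivity)

theorem deriv_mul_le (hgg' : ∀ t, 0 < t → HasDerivAt g (g' t) t) {k : ℝ}
    (h : ∀ t, 0 < t → t * g' t ≤ k * g t) {l t : ℝ} (hl : 1 ≤ l) (ht : 0 < t) :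
    g (l * t) ≤ l ^ k * g t := by
  have hanti := monotoneOn_div_rpow (g := fun t => -g t) (g' := fun t => -g' t) (k := k)
    (fun t ht => (hgg' t ht).neg) (fun t ht => by linarith [h t ht])
  have hl0 : 0 < l := by linarith
  have hlt : 0 < l * t := by positivity
  have h1 := hanti (Set.mem_Ioi.2 ht) (Set.mem_Ioi.2 hlt) (by nlinarith)
  simp only [neg_div, neg_le_neg_iff] at h1
  rw [div_le_iff₀ (by positivity), Real.mul_rpow hl0.le ht.le] at h1
  have := Real.rpow_pos_of_pos ht k
  calc g (l * t) ≤ g t / t ^ k * (l ^ k * t ^ k) := h1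
    _ = l ^ k * g t := by field_simp

/-- The growth condition on `g` gives the `Δ₂` condition for `G`. -/
theorem IsNFunction.mul_le (hG : IsNFunction G) (hGg : ∀ t, 0 < t → HasDerivAt G (g t) t)
    {k l : ℝ} (hl : 1 ≤ l) (h : ∀ t, 0 < t → g (l * t) ≤ l ^ k * g t) {t : ℝ} (ht : 0 ≤ t) :
    G (l * t) ≤ l ^ (k + 1) * G t := by
  have hl0 : 0 < l := by linarith
  have h0 : G 0 = 0 := (hG.2.2.1 0 le_rfl).2 rfl
  have hmono : MonotoneOn (fun t => l ^ (k + 1) * G t - G (l * t)) (Set.Ici 0) := by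
    refine monotoneOn_of_deriv_nonneg (convex_Ici 0) ?_ ?_ ?_
    · refine (continuousOn_const.mul hG.1).sub (hG.1.comp (by fun_prop) ?_)
      exact fun t (ht : 0 ≤ t) => Set.mem_Ici.2 (by positivity)
    all_goals
      rw [interior_Ici]
      intro t (ht : 0 < t)
      have hd : HasDerivAt (fun t => l ^ (k + 1) * G t - G (l * t))
          (l ^ (k + 1) * g t - g (l * t) * l) t := by
        refine ((hGg t ht).const_mul _).sub ?_
        have := (hasDerivAt_id t).const_mul l
        rw [mul_one] at this
        exact (hGg (l * t) (by positivity)).comp t this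
    · exact hd.differentiableAt.differentiableWithinAt
    · rw [hd.deriv, Real.rpow_add_one hl0.ne']
      have := mul_le_mul_of_nonneg_right (h t ht) hl0.le
      linarith
  have := hmono (Set.mem_Ici.2 le_rfl) (Set.mem_Ici.2 ht) ht
  simp only [mul_zero, h0, sub_zero] at this
  linarith

theorem IsNFunction.monotoneOn (hG : IsNFunction G) (hGg : ∀ t, 0 < t → HasDerivAt G (g t) t)
    (hg : ∀ t, 0 < t → 0 < g t) : MonotoneOn G (Set.Ici 0) := by
  refine monotoneOn_of_deriv_nonneg (convex_Ici 0) hG.1 ?_ ?_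
  all_goals
    rw [interior_Ici]
    intro t (ht : 0 < t)
  · exact (hGg t ht).differentiableAt.differentiableWithinAt
  · rw [(hGg t ht).deriv]
    exact (hg t ht).le

end NFunction

theorem diazSaa_bracket_abs_le {q M a b c d : ℝ} (hq : 1 < q) (hM : 1 ≤ M)
    (hac : ComparablePair M a c) (hbd : ComparablePair M b d) :
    |(a ^ q - c ^ q) / a ^ (q - 1) - (b ^ q - d ^ q) / b ^ (q - 1)|
      ≤ (1 + q * M ^ q) * (|a - b| + |c - d|) := by
  have hMq : 1 ≤ M ^ q := Real.one_le_rpow hM (by linarith)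
  have single : ∀ {a c : ℝ}, 0 < a → 0 < c → c ≤ M * a →
      |(a ^ q - c ^ q) / a ^ (q - 1)| ≤ (1 + q * M ^ q) * (a + c) := by
    intro a c ha hc h
    have h1 : c ^ q / a ^ (q - 1) ≤ M ^ q * a := by
      rw [div_le_iff₀ (by positivity)]
      calc c ^ q ≤ (M * a) ^ q := Real.rpow_le_rpow hc.le h (by linarith)
        _ = M ^ q * a * a ^ (q - 1) := by
          rw [Real.mul_rpow (by linarith) ha.le, Real.rpow_sub_one ha.ne']
          field_simp
    have h2 : 0 ≤ c ^ q / a ^ (q - 1) := by positivity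
    have h3 : M ^ q * a ≤ q * M ^ q * a := by
      have : 0 ≤ M ^ q * a := by positivity
      nlinarith
    have h4 : 0 ≤ q * M ^ q * c := by positivity
    rw [rpow_sub_rpow_div_rpow_sub_one ha, abs_le]
    constructor <;> nlinarith
  rcases hac with ⟨ha, hc, hac, hca⟩ | ⟨rfl, rfl⟩ <;>
    rcases hbd with ⟨hb, hd, hbd, hdb⟩ | ⟨rfl, rfl⟩
  · rw [rpow_sub_rpow_div_rpow_sub_one ha, rpow_sub_rpow_div_rpow_sub_one hb]
    have h1 := rpow_div_rpow_sub_le hq hM ha hb hc hd hca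
    have h2 := rpow_div_rpow_sub_le hq hM hb ha hd hc hdb
    rw [abs_sub_comm b, abs_sub_comm d] at h2
    have h3 := abs_nonneg (c - d)
    have h4 := neg_abs_le (a - b)
    have h5 := le_abs_self (a - b)
    rw [abs_le]
    constructor <;> linarith
  · simpa [abs_of_pos ha, abs_of_pos hc] using single ha hc hca
  · simpa [abs_of_pos hb, abs_of_pos hd] using single hb hd hdb
  · simp

section Integrability

variable {N : ℕ} {G g g' : ℝ → ℝ} {s q M : ℝ} {u v : Euc N → ℝ}

theorem diazSaaIntegrand_eq (p : Euc N × Euc N) :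
    diazSaaIntegrand g s q N u v p
      = diazSaaNumerator (fun t => g (t / dist p.1 p.2 ^ s)) q (u p.1) (u p.2) (v p.1) (v p.2)
        / dist p.1 p.2 ^ ((N : ℝ) + s) := rfl

theorem diazSaaIntegrand_of_dist_eq_zero (hs : 0 < s) {p : Euc N × Euc N}
    (hp : dist p.1 p.2 = 0) : diazSaaIntegrand g s q N u v p = 0 := by
  have : (N : ℝ) + s ≠ 0 := by positivity
  rw [diazSaaIntegrand_eq, hp, Real.zero_rpow this, div_zero]

theorem measurable_real_sign : Measurable Real.sign :=
  Measurable.ite measurableSet_Iio measurable_const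
    (Measurable.ite measurableSet_Ioi measurable_const measurable_const)

theorem measurable_diazSaaIntegrand (hg : ContinuousOn g (Set.Ioi 0)) (hs : 0 < s)
    (hu : Measurable u) (hv : Measurable v) :
    Measurable (diazSaaIntegrand g s q N u v) := by
  classical
  have hm : Measurable ((Set.Ioi (0 : ℝ)).piecewise g 0) :=
    hg.measurable_piecewise continuous_zero.continuousOn measurableSet_Ioi
  have heq : diazSaaIntegrand g s q N u v
      = diazSaaIntegrand ((Set.Ioi (0 : ℝ)).piecewise g 0) s q N u v := by
    funext p
    rcases (dist_nonneg (x := p.1) (y := p.2)).eq_or_lt with h | h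
    · rw [diazSaaIntegrand_of_dist_eq_zero hs h.symm, diazSaaIntegrand_of_dist_eq_zero hs h.symm]
    by_cases hX : u p.1 - u p.2 = 0
    · simp [diazSaaIntegrand, hX]
    · have : 0 < |u p.1 - u p.2| / dist p.1 p.2 ^ s := by
        have := abs_pos.2 hX
        positivity
      rw [diazSaaIntegrand, diazSaaIntegrand, Set.piecewise_eq_of_mem _ _ _ (Set.mem_Ioi.2 this)]
  rw [heq]
  have hu1 : Measurable fun p : Euc N × Euc N => u p.1 := hu.comp measurable_fst
  have hu2 : Measurable fun p : Euc N × Euc N => u p.2 := hu.comp measurable_snd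
  have hv1 : Measurable fun p : Euc N × Euc N => v p.1 := hv.comp measurable_fst
  have hv2 : Measurable fun p : Euc N × Euc N => v p.2 := hv.comp measurable_snd
  have hd : Measurable fun p : Euc N × Euc N => dist p.1 p.2 := measurable_dist
  unfold diazSaaIntegrand
  refine Measurable.div (Measurable.mul (Measurable.mul (hm.comp ?_)
    (measurable_real_sign.comp (hu1.sub hu2))) ?_) (hd.pow_const _)
  · exact (measurable_abs.comp (hu1.sub hu2)).div (hd.pow_const _)
  · exact (((hu1.pow_const _).sub (hv1.pow_const _)).div (hu1.pow_const _)).sub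
      (((hu2.pow_const _).sub (hv2.pow_const _)).div (hu2.pow_const _))

theorem IsNFunction.measurable_energy (hG : IsNFunction G) (hu : Measurable u) {l : ℝ}
    (hl : 0 ≤ l) :
    Measurable fun p : Euc N × Euc N =>
      G (l * (|u p.1 - u p.2| / dist p.1 p.2 ^ s)) / dist p.1 p.2 ^ (N : ℝ) := by
  have hu1 : Measurable fun p : Euc N × Euc N => u p.1 := hu.comp measurable_fst
  have hu2 : Measurable fun p : Euc N × Euc N => u p.2 := hu.comp measurable_snd
  have hd : Measurable fun p : Euc N × Euc N => dist p.1 p.2 := measurable_dist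
  have hc : Continuous fun t => G |t| :=
    hG.1.comp_continuous continuous_abs fun t => Set.mem_Ici.2 (abs_nonneg t)
  have hm := (hc.measurable.comp ((((measurable_abs.comp (hu1.sub hu2)).div
    (hd.pow_const s))).const_mul l)).div (hd.pow_const (N : ℝ))
  convert hm using 1
  funext p
  simp only [Pi.div_apply, Function.comp_apply, Pi.sub_apply]
  rw [abs_of_nonneg (a := l * _) (by positivity)]

theorem IsNFunction.integrable_energy (hG : IsNFunction G)
    (hGg : ∀ t, 0 < t → HasDerivAt G (g t) t) (hg : ∀ t, 0 < t → 0 < g t) {k : ℝ}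
    (hk : ∀ l t, 1 ≤ l → 0 < t → g (l * t) ≤ l ^ k * g t) (hu : Measurable u)
    (hmod : ∃ l > 0, fracModular G s N (fun x => u x / l) < ⊤) :
    Integrable fun p : Euc N × Euc N =>
      G (2 * (|u p.1 - u p.2| / dist p.1 p.2 ^ s)) / dist p.1 p.2 ^ (N : ℝ) := by
  obtain ⟨l, hl, hfin⟩ := hmod
  have hnonneg : ∀ (w : Euc N → ℝ) (m : ℝ), 0 ≤ m → ∀ p : Euc N × Euc N,
      0 ≤ G (m * (|w p.1 - w p.2| / dist p.1 p.2 ^ s)) / dist p.1 p.2 ^ (N : ℝ) :=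
    fun w m hm p => div_nonneg (hG.nonneg (by positivity)) (by positivity)
  have hint : Integrable fun p : Euc N × Euc N =>
      G (1 * (|u p.1 / l - u p.2 / l| / dist p.1 p.2 ^ s)) / dist p.1 p.2 ^ (N : ℝ) := by
    refine ⟨(hG.measurable_energy (hu.div_const l) zero_le_one).aestronglyMeasurable, ?_⟩
    rw [hasFiniteIntegral_iff_ofReal
      (Eventually.of_forall (hnonneg (fun x => u x / l) 1 zero_le_one))]
    simpa only [fracModular, one_mul] using hfin
  refine (hint.const_mul (max (2 * l) 1 ^ (k + 1))).mono'
    (hG.measurable_energy hu (zero_le_two (α := ℝ))).aestronglyMeasurable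
    (Eventually.of_forall fun p => ?_)
  rw [Real.norm_of_nonneg (hnonneg u 2 zero_le_two p), one_mul, ← mul_div_assoc (max (2 * l) 1 ^ (k + 1))]
  have hL : 1 ≤ max (2 * l) 1 := le_max_right _ _
  have h0 : 0 ≤ |u p.1 / l - u p.2 / l| / dist p.1 p.2 ^ s := by positivity
  have hn : 0 ≤ dist p.1 p.2 ^ (N : ℝ) := by positivity
  refine div_le_div_of_nonneg_right ?_ hn
  refine le_trans ?_ (hG.mul_le hGg hL (fun t ht => hk _ t hL ht) h0)
  have heq : 2 * (|u p.1 - u p.2| / dist p.1 p.2 ^ s)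
      = 2 * l * (|u p.1 / l - u p.2 / l| / dist p.1 p.2 ^ s) := by
    rw [← sub_div, abs_div, abs_of_pos hl]
    field_simp
  rw [heq]
  refine hG.monotoneOn hGg hg (Set.mem_Ici.2 (by positivity))
    (Set.mem_Ici.2 (mul_nonneg (by linarith) h0)) ?_
  exact mul_le_mul_of_nonneg_right (le_max_left _ _) h0

/-- A Young-type inequality. -/
theorem IsNFunction.deriv_mul_add_le (hG : IsNFunction G)
    (hGg : ∀ t, 0 < t → HasDerivAt G (g t) t) (hg : ∀ t, 0 < t → 0 < g t)
    (hmono : MonotoneOn g (Set.Ioi 0)) {α β : ℝ} (hα : 0 < α) (hβ : 0 ≤ β) :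
    g α * (α + β) ≤ 2 * (G (2 * α) + G (2 * β)) := by
  have h1 : 0 ≤ G (2 * α) := hG.nonneg (by linarith)
  have h2 : 0 ≤ G (2 * β) := hG.nonneg (by linarith)
  have h3 := hg α hα
  rcases le_or_gt β α with h | h
  · have := hG.mul_deriv_le hα (hGg α hα)
    nlinarith
  · have hβ := hα.trans h
    have h4 := hG.mul_deriv_le hβ (hGg β hβ)
    have h5 := hmono hα hβ h.le
    nlinarith

theorem IsNFunction.integrable_diazSaaIntegrand (hG : IsNFunction G)
    (hGg : ∀ t, 0 < t → HasDerivAt G (g t) t) (hg : ∀ t, 0 < t → 0 < g t)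
    (hcont : ContinuousOn g (Set.Ioi 0)) (hmono : MonotoneOn g (Set.Ioi 0)) {k : ℝ}
    (hk : ∀ l t, 1 ≤ l → 0 < t → g (l * t) ≤ l ^ k * g t)
    (hs : 0 < s) (hq : 1 < q) (hM : 1 ≤ M) (hu : Measurable u) (hv : Measurable v)
    (hmodu : ∃ l > 0, fracModular G s N (fun x => u x / l) < ⊤)
    (hmodv : ∃ l > 0, fracModular G s N (fun x => v x / l) < ⊤)
    (hcomp : ∀ᵐ p : Euc N × Euc N,
      ComparablePair M (u p.1) (v p.1) ∧ ComparablePair M (u p.2) (v p.2)) :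
    Integrable (diazSaaIntegrand g s q N u v) := by
  have hiu := hG.integrable_energy hGg hg hk hu hmodu
  have hiv := hG.integrable_energy hGg hg hk hv hmodv
  refine ((hiu.add hiv).const_mul ((1 + q * M ^ q) * 2)).mono'
    (measurable_diazSaaIntegrand hcont hs hu hv).aestronglyMeasurable ?_
  filter_upwards [hcomp] with p ⟨h1, h2⟩
  have hGn : ∀ t, 0 ≤ t → 0 ≤ G (2 * t) := fun t ht => hG.nonneg (by positivity)
  have hKpos : 0 ≤ 1 + q * M ^ q := by positivity
  have hrhs : 0 ≤ (1 + q * M ^ q) * 2 *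
      (G (2 * (|u p.1 - u p.2| / dist p.1 p.2 ^ s)) / dist p.1 p.2 ^ (N : ℝ)
        + G (2 * (|v p.1 - v p.2| / dist p.1 p.2 ^ s)) / dist p.1 p.2 ^ (N : ℝ)) := by
    have h3 := hGn (|u p.1 - u p.2| / dist p.1 p.2 ^ s) (by positivity)
    have h4 := hGn (|v p.1 - v p.2| / dist p.1 p.2 ^ s) (by positivity)
    positivity
  simp only [Pi.add_apply]
  rcases (dist_nonneg (x := p.1) (y := p.2)).eq_or_lt with h | h
  · rwa [diazSaaIntegrand_of_dist_eq_zero hs h.symm, norm_zero]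
  by_cases hX : u p.1 - u p.2 = 0
  · have : diazSaaIntegrand g s q N u v p = 0 := by simp [diazSaaIntegrand, hX]
    rwa [this, norm_zero]
  have hX := abs_pos.2 hX
  have hr : 0 < dist p.1 p.2 ^ s := Real.rpow_pos_of_pos h s
  have hn : 0 < dist p.1 p.2 ^ (N : ℝ) := Real.rpow_pos_of_pos h _
  have hα : 0 < |u p.1 - u p.2| / dist p.1 p.2 ^ s := by positivity
  have hβ : 0 ≤ |v p.1 - v p.2| / dist p.1 p.2 ^ s := by positivity
  have hY := hG.deriv_mul_add_le hGg hg hmono hα hβ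
  have hB := diazSaa_bracket_abs_le hq hM h1 h2
  have hgα := hg _ hα
  have hsign : |Real.sign (u p.1 - u p.2)| ≤ 1 := by
    rcases Real.sign_apply_eq (u p.1 - u p.2) with h | h | h <;> simp [h]
  rw [diazSaaIntegrand, Real.norm_eq_abs, abs_div, abs_mul, abs_mul, abs_of_pos hgα,
    abs_of_pos (Real.rpow_pos_of_pos h _), Real.rpow_add h, ← add_div, ← mul_div_assoc,
    div_le_div_iff₀ (by positivity) hn]
  generalize |u p.1 - u p.2| = X at *
  generalize |v p.1 - v p.2| = Y at *
  generalize dist p.1 p.2 ^ s = r at *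
  generalize dist p.1 p.2 ^ (N : ℝ) = n at *
  have hXY : X + Y = (X / r + Y / r) * r := by field_simp
  calc _ ≤ g (X / r) * 1 * ((1 + q * M ^ q) * (X + Y)) * n := by gcongr
    _ = (1 + q * M ^ q) * (g (X / r) * (X / r + Y / r)) * r * n := by rw [hXY]; ring
    _ ≤ (1 + q * M ^ q) * (2 * (G (2 * (X / r)) + G (2 * (Y / r)))) * r * n := by gcongr
    _ = _ := by ring

end Integrability

theorem comp_div_div_rpow {g : ℝ → ℝ} {r k t : ℝ} (hr : 0 < r) (ht : 0 < t) :
    g (t / r) / t ^ k = g (t / r) / (t / r) ^ k / r ^ k := by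
  rw [Real.div_rpow ht.le hr.le]
  have := Real.rpow_pos_of_pos hr k
  have := Real.rpow_pos_of_pos ht k
  field_simp

theorem monotoneOn_comp_div {g : ℝ → ℝ} {r k : ℝ} (hr : 0 < r)
    (h : MonotoneOn (fun t => g t / t ^ k) (Set.Ioi 0)) :
    MonotoneOn (fun t => g (t / r) / t ^ k) (Set.Ioi 0) := by
  intro x (hx : 0 < x) y (hy : 0 < y) hxy
  simp only [comp_div_div_rpow hr hx, comp_div_div_rpow hr hy]
  exact div_le_div_of_nonneg_right
    (h (div_pos hx hr) (div_pos hy hr) (by gcongr)) (by positivity)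

theorem strictMonoOn_comp_div {g : ℝ → ℝ} {r k : ℝ} (hr : 0 < r)
    (h : StrictMonoOn (fun t => g t / t ^ k) (Set.Ioi 0)) :
    StrictMonoOn (fun t => g (t / r) / t ^ k) (Set.Ioi 0) := by
  intro x (hx : 0 < x) y (hy : 0 < y) hxy
  simp only [comp_div_div_rpow hr hx, comp_div_div_rpow hr hy]
  exact div_lt_div_of_pos_right
    (h (div_pos hx hr) (div_pos hy hr) (by gcongr)) (by positivity)

/-- equality case in the G-fractional Díaz–Saa inequality: under the same
hypotheses, if the sum of the two Díaz–Saa integrals vanishes, then `u/v` is a.e. equal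
to a positive constant in `Ω`; if moreover `q ≠ p⁻`, then `u = v` a.e. in `Ω`. Original:
`0 < s < 1`, `Ω ⊂ ℝ^N` a bounded domain, `1 < q ≤ p⁻`, and `u, v ∈ W^{s,G}_0(Ω)` positive
a.e. in `Ω` with `u/v, v/u ∈ L^∞(Ω)`, both Díaz–Saa double integrals are well-defined
Lebesgue integrals and their sum is nonnegative. -/
theorem G_fractional_diaz_saa_equality_case
    {N : ℕ} (hN : 0 < N)
    (G g g' : ℝ → ℝ) (pm pp : ℝ) (hG : IsNFunction G)
    (hGg : ∀ t : ℝ, 0 < t → HasDerivAt G (g t) t)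
    (hgg' : ∀ t : ℝ, 0 < t → HasDerivAt g (g' t) t)
    (hg'cont : ContinuousOn g' (Set.Ioi 0))
    (hpm : 1 < pm - 1) (hpmpp : pm ≤ pp)
    (hH4 : ∀ t : ℝ, 0 < t → pm - 1 ≤ t * g' t / g t ∧ t * g' t / g t ≤ pp - 1)
    (s : ℝ) (hs0 : 0 < s) (hs1 : s < 1)
    (Ω : Set (Euc N)) (hΩopen : IsOpen Ω) (hΩbd : Bornology.IsBounded Ω)
    (hΩconn : IsConnected Ω)
    (q : ℝ) (hq1 : 1 < q) (hqpm : q ≤ pm)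
    (u v : Euc N → ℝ)
    (hu : MemW0 G s Ω u) (hv : MemW0 G s Ω v)
    (hupos : ∀ᵐ x ∂(volume.restrict Ω), 0 < u x)
    (hvpos : ∀ᵐ x ∂(volume.restrict Ω), 0 < v x)
    (hratio : ∃ M : ℝ, ∀ᵐ x ∂(volume.restrict Ω), u x ≤ M * v x ∧ v x ≤ M * u x)
    (heq : (∫ p : Euc N × Euc N, diazSaaIntegrand g s q N u v p)
        + (∫ p : Euc N × Euc N, diazSaaIntegrand g s q N v u p) = 0) :
    (∃ c : ℝ, 0 < c ∧ ∀ᵐ x ∂(volume.restrict Ω), u x = c * v x) ∧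
    (q ≠ pm → ∀ᵐ x ∂(volume.restrict Ω), u x = v x) := by
  have hpm1 : 0 < pm - 1 := by linarith
  have hg_pos : ∀ t, 0 < t → 0 < g t := fun t ht =>
    hG.deriv_pos ht (hGg t ht) fun h0 => by
      have := (hH4 t ht).1
      rw [h0, div_zero] at this
      linarith
  have hlow : ∀ t, 0 < t → (pm - 1) * g t ≤ t * g' t := fun t ht =>
    (le_div_iff₀ (hg_pos t ht)).1 (hH4 t ht).1
  have hup : ∀ t, 0 < t → t * g' t ≤ (pp - 1) * g t := fun t ht =>
    (div_le_iff₀ (hg_pos t ht)).1 (hH4 t ht).2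
  have hcont : ContinuousOn g (Set.Ioi 0) := fun t ht =>
    (hgg' t ht).continuousAt.continuousWithinAt
  have hmono : MonotoneOn g (Set.Ioi 0) := by
    have := monotoneOn_div_rpow hgg' (k := 0) fun t ht => by
      have := mul_pos hpm1 (hg_pos t ht)
      linarith [hlow t ht]
    simpa using this
  have hmono_q : MonotoneOn (fun t => g t / t ^ (q - 1)) (Set.Ioi 0) :=
    monotoneOn_div_rpow hgg' fun t ht => by nlinarith [hlow t ht, hg_pos t ht]
  have hscale : ∀ l t : ℝ, 1 ≤ l → 0 < t → g (l * t) ≤ l ^ (pp - 1) * g t :=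
    fun l t => deriv_mul_le hgg' hup
  obtain ⟨M₀, hM₀⟩ := hratio
  have hcomp : ∀ᵐ x, ComparablePair (max M₀ 1) (u x) (v x) := by
    rw [ae_restrict_iff' hΩopen.measurableSet] at hupos hvpos hM₀
    filter_upwards [hupos, hvpos, hM₀] with x h1 h2 h3
    by_cases hx : x ∈ Ω
    · refine Or.inl ⟨h1 hx, h2 hx, (h3 hx).1.trans ?_, (h3 hx).2.trans ?_⟩
      · exact mul_le_mul_of_nonneg_right (le_max_left _ _) (h2 hx).le
      · exact mul_le_mul_of_nonneg_right (le_max_left _ _) (h1 hx).le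
    · exact Or.inr ⟨hu.2.2.2 x hx, hv.2.2.2 x hx⟩
  have hcomp₂ : ∀ᵐ p : Euc N × Euc N, ComparablePair (max M₀ 1) (u p.1) (v p.1) ∧
      ComparablePair (max M₀ 1) (u p.2) (v p.2) :=
    (Measure.quasiMeasurePreserving_fst.ae hcomp).and
      (Measure.quasiMeasurePreserving_snd.ae hcomp)
  have hint_u : Integrable (diazSaaIntegrand g s q N u v) :=
    hG.integrable_diazSaaIntegrand hGg hg_pos hcont hmono hscale hs0 hq1 (le_max_right _ _)
      hu.1 hv.1 hu.2.2.1 hv.2.2.1 hcomp₂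
  have hint_v : Integrable (diazSaaIntegrand g s q N v u) :=
    hG.integrable_diazSaaIntegrand hGg hg_pos hcont hmono hscale hs0 hq1 (le_max_right _ _)
      hv.1 hu.1 hv.2.2.1 hu.2.2.1 (hcomp₂.mono fun p h => ⟨h.1.symm, h.2.symm⟩)
  have hφpos : ∀ {r : ℝ}, 0 < r → ∀ t, 0 < t → 0 < g (t / r) := fun hr t ht =>
    hg_pos _ (div_pos ht hr)
  have hsum_nonneg : ∀ᵐ p : Euc N × Euc N,
      0 ≤ diazSaaIntegrand g s q N u v p + diazSaaIntegrand g s q N v u p := by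
    filter_upwards [hcomp₂] with p ⟨h1, h2⟩
    rcases (dist_nonneg (x := p.1) (y := p.2)).eq_or_lt with h | h
    · rw [diazSaaIntegrand_of_dist_eq_zero hs0 h.symm,
        diazSaaIntegrand_of_dist_eq_zero hs0 h.symm, add_zero]
    · have hr := Real.rpow_pos_of_pos h s
      rw [diazSaaIntegrand_eq, diazSaaIntegrand_eq, ← add_div]
      exact div_nonneg (diazSaa_pointwise_nonneg (hφpos hr) (monotoneOn_comp_div hr hmono_q)
        hq1 h1 h2) (by positivity)
  have hsum_zero : ∀ᵐ p : Euc N × Euc N, p.1 ≠ p.2 →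
      diazSaaNumerator (fun t => g (t / dist p.1 p.2 ^ s)) q (u p.1) (u p.2) (v p.1) (v p.2)
      + diazSaaNumerator (fun t => g (t / dist p.1 p.2 ^ s)) q (v p.1) (v p.2) (u p.1) (u p.2)
        = 0 := by
    have h0 := (integral_eq_zero_iff_of_nonneg_ae hsum_nonneg (hint_u.add hint_v)).1
      (by rw [← heq]; exact integral_add hint_u hint_v)
    filter_upwards [h0] with p hp hne
    have hd : 0 < dist p.1 p.2 := dist_pos.2 hne
    simp only [Pi.zero_apply, diazSaaIntegrand_eq, ← add_div] at hp
    exact (div_eq_zero_iff.1 hp).resolve_right (Real.rpow_pos_of_pos hd _).ne'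
  have hiter := Measure.ae_ae_of_ae_prod hsum_zero
  rw [ae_restrict_iff' hΩopen.measurableSet] at hupos hvpos
  have : Nonempty (Fin N) := ⟨⟨0, hN⟩⟩
  constructor
  · have hΩpos : volume Ω ≠ 0 := (hΩopen.measure_pos volume hΩconn.nonempty).ne'
    obtain ⟨x, hxΩ, hx⟩ : ∃ x ∈ Ω, 0 < u x ∧ 0 < v x ∧ ∀ᵐ y, x ≠ y →
        diazSaaNumerator (fun t => g (t / dist x y ^ s)) q (u x) (u y) (v x) (v y)
        + diazSaaNumerator (fun t => g (t / dist x y ^ s)) q (v x) (v y) (u x) (u y) = 0 := by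
      have hfreq : ∃ᶠ x in ae volume, x ∈ Ω := frequently_ae_mem_iff.2 hΩpos
      obtain ⟨x, hxΩ, h1, h2, h3⟩ :=
        (hfreq.and_eventually (hupos.and (hvpos.and hiter))).exists
      exact ⟨x, hxΩ, h1 hxΩ, h2 hxΩ, h3⟩
    obtain ⟨hux, hvx, hx⟩ := hx
    refine ⟨u x / v x, div_pos hux hvx, ?_⟩
    rw [ae_restrict_iff' hΩopen.measurableSet]
    have hne : ∀ᵐ y : Euc N, y ≠ x := Measure.ae_ne volume x
    filter_upwards [hx, hupos, hvpos, hne] with y hy huy hvy hyx hyΩ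
    have hr := Real.rpow_pos_of_pos (dist_pos.2 hyx.symm) s
    by_contra hcon
    refine ((diazSaa_pointwise (hφpos hr) (monotoneOn_comp_div hr hmono_q) hq1 hux (huy hyΩ)
      hvx (hvy hyΩ)).2 fun h => hcon ?_).ne' (hy hyx.symm)
    field_simp
    linarith
  · intro hqne
    have hqlt : q < pm := lt_of_le_of_ne hqpm hqne
    have hstrict : StrictMonoOn (fun t => g t / t ^ (q - 1)) (Set.Ioi 0) :=
      strictMonoOn_div_rpow hgg' fun t ht => by nlinarith [hlow t ht, hg_pos t ht]
    have hcompl : volume Ωᶜ ≠ 0 := by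
      intro h0
      have h1 := measure_univ_le_add_compl (μ := volume) Ω
      rw [h0, add_zero, measure_univ_of_isAddLeftInvariant, top_le_iff] at h1
      exact hΩbd.measure_lt_top.ne h1
    rw [ae_restrict_iff' hΩopen.measurableSet]
    filter_upwards [hiter, hupos, hvpos] with x hx hux hvx hxΩ
    obtain ⟨y, hyΩ, hy⟩ := ((frequently_ae_mem_iff.2 hcompl).and_eventually hx).exists
    have hxy : x ≠ y := fun h => hyΩ (h ▸ hxΩ)
    have hr := Real.rpow_pos_of_pos (dist_pos.2 hxy) s
    have h0 := hy hxy
    simp only [hu.2.2.2 y hyΩ, hv.2.2.2 y hyΩ] at h0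
    rw [diazSaa_pointwise_boundary (hux hxΩ) (hvx hxΩ)] at h0
    by_contra hcon
    exact (rpow_sub_mul_strictMono_pos (strictMonoOn_comp_div hr hstrict) (by linarith)
      (hux hxΩ) (hvx hxΩ) hcon).ne' h0
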